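/- Let σ > 0 and let C(A, σ) denote the capacity of the amplitude-constrained Gaussian channel with amplitude constraint A and noise standard deviation σ. Then lim_{A → 0⁺} C(A, σ) / (A²/(2σ²)) = 1. -/

import Mathlib

open MeasureTheory ProbabilityTheory Real Filter Set
open scoped Classical

noncomputable section

/-- Kullback–Leibler divergence of `μ` from `ν` (valued in `EReal`; `⊤` when undefined). -/
def klDiv {α : Type*} [MeasurableSpace α] (μ ν : Measure α) : EReal :=
  if μ ≪ ν ∧ Integrable (llr μ ν) μ then ((∫ x, llr μ ν x ∂μ : ℝ) : EReal) else ⊤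

/-- Mutual information `I(U;V)` under `P`: the KL divergence of the joint law of `(U,V)`
from the product of its marginal laws. -/
def mutualInfo {Ω α β : Type*} [MeasurableSpace Ω] [MeasurableSpace α] [MeasurableSpace β]
    (P : Measure Ω) (U : Ω → α) (V : Ω → β) : EReal :=
  klDiv (P.map (fun ω => (U ω, V ω))) ((P.map U).prod (P.map V))

/-- Capacity of the amplitude-constrained Gaussian channel with amplitude constraint `A`
and noise standard deviation `σ`. -/
def gaussCap (A σ : ℝ) : EReal :=
  sSup {r : EReal | ∃ μ : Measure ℝ, IsProbabilityMeasure μ ∧ μ (Set.Icc (-A) A)ᶜ = 0 ∧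
    r = mutualInfo (μ.prod (gaussianReal 0 (σ ^ 2).toNNReal))
      (fun ω => ω.1) (fun ω => ω.1 + ω.2)}

/-- The density at `y` of the Gaussian law with mean `x` and variance `v` with respect to the
centred Gaussian law of the same variance. -/
def gaussTilt (v : NNReal) (x y : ℝ) : ℝ := Real.exp (x * y / v - x ^ 2 / (2 * v))

/-- The density at `y` of the output law of the Gaussian channel with input law `μ`, with respect
to the noise law. -/
def outputTilt (μ : Measure ℝ) (v : NNReal) (y : ℝ) : ℝ := ∫ x, gaussTilt v x y ∂μ

lemma gaussTilt_pos (v : NNReal) (x y : ℝ) : 0 < gaussTilt v x y := Real.exp_pos _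

lemma measurable_gaussTilt (v : NNReal) :
    Measurable (fun p : ℝ × ℝ => gaussTilt v p.1 p.2) := by
  unfold gaussTilt; fun_prop

lemma gaussianReal_eq_withDensity_gaussTilt {v : NNReal} (hv : v ≠ 0) (x : ℝ) :
    gaussianReal x v
      = (gaussianReal 0 v).withDensity (fun y => ENNReal.ofReal (gaussTilt v x y)) := by
  have hm : Measurable (fun y => ENNReal.ofReal (gaussTilt v x y)) :=
    ((measurable_gaussTilt v).comp measurable_prodMk_left).ennreal_ofReal
  rw [gaussianReal_of_var_ne_zero _ hv, gaussianReal_of_var_ne_zero _ hv,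
    ← withDensity_mul _ (measurable_gaussianPDF _ _) hm]
  congr 1
  ext y
  have hv' : (v : ℝ) ≠ 0 := by exact_mod_cast hv
  simp only [gaussianPDF, Pi.mul_apply]
  rw [← ENNReal.ofReal_mul (gaussianPDFReal_nonneg _ _ _)]
  congr 1
  simp only [gaussianPDFReal, gaussTilt]
  rw [mul_assoc _ (Real.exp _) (Real.exp _), ← Real.exp_add]
  congr 2
  field_simp
  ring

/-- The joint law of the input and the output of the Gaussian channel. -/
lemma map_channel_eq_withDensity (μ : Measure ℝ) [IsProbabilityMeasure μ] {v : NNReal}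
    (hv : v ≠ 0) :
    (μ.prod (gaussianReal 0 v)).map (fun ω => (ω.1, ω.1 + ω.2))
      = (μ.prod (gaussianReal 0 v)).withDensity
          (fun p => ENNReal.ofReal (gaussTilt v p.1 p.2)) := by
  have hr := (measurable_gaussTilt v).ennreal_ofReal
  refine Measure.ext_of_lintegral _ fun f hf => ?_
  rw [lintegral_map hf (by fun_prop), lintegral_withDensity_eq_lintegral_mul _ hr hf,
    lintegral_prod _ (by fun_prop), lintegral_prod _ (hr.mul hf).aemeasurable]
  refine lintegral_congr fun x => ?_
  have h1 : (gaussianReal 0 v).map (fun n => x + n) = gaussianReal x v := by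
    simpa using gaussianReal_map_const_add (μ := 0) (v := v) x
  have hrx : Measurable (fun y => ENNReal.ofReal (gaussTilt v x y)) :=
    hr.comp measurable_prodMk_left
  have hfx : Measurable (fun y => f (x, y)) := hf.comp measurable_prodMk_left
  have h2 : ∫⁻ n, f (x, x + n) ∂(gaussianReal 0 v) = ∫⁻ y, f (x, y) ∂(gaussianReal x v) := by
    rw [← h1, lintegral_map hfx (by fun_prop)]
  simp only
  rw [h2, gaussianReal_eq_withDensity_gaussTilt hv x,
    lintegral_withDensity_eq_lintegral_mul _ hrx hfx]
  rfl

lemma ae_abs_le_of_compl_Icc {μ : Measure ℝ} {A : ℝ} (hμ : μ (Set.Icc (-A) A)ᶜ = 0) : ∀ᵐ x ∂μ, |x| ≤ A := by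
  have : ∀ᵐ x ∂μ, x ∈ Set.Icc (-A) A := hμ
  filter_upwards [this] with x hx using abs_le.2 hx

section Channel

variable {μ : Measure ℝ} [IsProbabilityMeasure μ] {A : ℝ} {v : NNReal}

lemma abs_gaussTilt_exponent_le {x : ℝ} (hx : |x| ≤ A) (y : ℝ) :
    |x * y / v - x ^ 2 / (2 * v)| ≤ A * |y| / v + A ^ 2 / (2 * v) := by
  refine (abs_sub _ _).trans ?_
  have h2 : x ^ 2 ≤ A ^ 2 := by
    rw [← sq_abs]; gcongr
  have h3 : |x * y / v| = |x| * |y| / v := by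
    rw [abs_div, abs_mul, abs_of_nonneg v.coe_nonneg]
  rw [h3, abs_of_nonneg (by positivity : 0 ≤ x ^ 2 / (2 * (v : ℝ)))]
  gcongr

lemma integrable_gaussTilt (hμ : ∀ᵐ x ∂μ, |x| ≤ A) (y : ℝ) :
    Integrable (fun x => gaussTilt v x y) μ := by
  refine Integrable.of_bound
    ((measurable_gaussTilt v).comp measurable_prodMk_right).aestronglyMeasurable
    (Real.exp (A * |y| / v + A ^ 2 / (2 * v))) ?_
  filter_upwards [hμ] with x hx
  rw [Real.norm_of_nonneg (gaussTilt_pos _ _ _).le]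
  exact Real.exp_le_exp.2 ((le_abs_self _).trans (abs_gaussTilt_exponent_le hx y))

lemma outputTilt_mem_Icc (hμ : ∀ᵐ x ∂μ, |x| ≤ A) (y : ℝ) :
    outputTilt μ v y ∈ Set.Icc (Real.exp (-(A * |y| / v + A ^ 2 / (2 * v))))
      (Real.exp (A * |y| / v + A ^ 2 / (2 * v))) := by
  constructor
  · have : ∫ _, Real.exp (-(A * |y| / v + A ^ 2 / (2 * v))) ∂μ ≤ outputTilt μ v y := by
      refine integral_mono_ae (integrable_const _) (integrable_gaussTilt hμ y) ?_
      filter_upwards [hμ] with x hx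
      exact Real.exp_le_exp.2 (abs_le.1 (abs_gaussTilt_exponent_le hx y)).1
    simpa using this
  · have : outputTilt μ v y ≤ ∫ _, Real.exp (A * |y| / v + A ^ 2 / (2 * v)) ∂μ := by
      refine integral_mono_ae (integrable_gaussTilt hμ y) (integrable_const _) ?_
      filter_upwards [hμ] with x hx
      exact Real.exp_le_exp.2 (abs_le.1 (abs_gaussTilt_exponent_le hx y)).2
    simpa using this

lemma outputTilt_pos (hμ : ∀ᵐ x ∂μ, |x| ≤ A) (y : ℝ) : 0 < outputTilt μ v y :=
  (Real.exp_pos _).trans_le (outputTilt_mem_Icc hμ y).1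

lemma abs_log_outputTilt_le (hμ : ∀ᵐ x ∂μ, |x| ≤ A) (y : ℝ) :
    |Real.log (outputTilt μ v y)| ≤ A * |y| / v + A ^ 2 / (2 * v) := by
  have h := outputTilt_mem_Icc (v := v) hμ y
  have hp := outputTilt_pos (v := v) hμ y
  exact abs_le.2 ⟨(Real.le_log_iff_exp_le hp).2 h.1, (Real.log_le_iff_le_exp hp).2 h.2⟩

lemma measurable_outputTilt : Measurable (outputTilt μ v) :=
  ((measurable_gaussTilt v).stronglyMeasurable.integral_prod_left').measurable

/-- The output law of the Gaussian channel. -/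
lemma map_output_eq_withDensity (hv : v ≠ 0) (hμ : ∀ᵐ x ∂μ, |x| ≤ A) :
    (μ.prod (gaussianReal 0 v)).map (fun ω => ω.1 + ω.2)
      = (gaussianReal 0 v).withDensity (fun y => ENNReal.ofReal (outputTilt μ v y)) := by
  have hr := (measurable_gaussTilt v).ennreal_ofReal
  have hmap : (μ.prod (gaussianReal 0 v)).map (fun ω => ω.1 + ω.2)
      = ((μ.prod (gaussianReal 0 v)).map (fun ω => (ω.1, ω.1 + ω.2))).map Prod.snd := by
    rw [Measure.map_map measurable_snd (by fun_prop)]; rfl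
  rw [hmap, map_channel_eq_withDensity μ hv]
  refine Measure.ext_of_lintegral _ fun f hf => ?_
  have hf2 : Measurable (fun p : ℝ × ℝ => f p.2) := hf.comp measurable_snd
  rw [lintegral_map hf measurable_snd, lintegral_withDensity_eq_lintegral_mul _ hr hf2,
    lintegral_withDensity_eq_lintegral_mul _ measurable_outputTilt.ennreal_ofReal hf,
    lintegral_prod_symm' _ (hr.mul hf2)]
  refine lintegral_congr fun y => ?_
  have hry : Measurable (fun x => ENNReal.ofReal (gaussTilt v x y)) :=
    hr.comp measurable_prodMk_right
  simp only [Pi.mul_apply]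
  rw [lintegral_mul_const _ hry, outputTilt,
    ofReal_integral_eq_lintegral_ofReal (integrable_gaussTilt hμ y)
      (ae_of_all _ fun x => (gaussTilt_pos v x y).le)]

lemma map_channel_eq_withDensity_prod (hv : v ≠ 0) (hμ : ∀ᵐ x ∂μ, |x| ≤ A) :
    (μ.prod (gaussianReal 0 v)).map (fun ω => (ω.1, ω.1 + ω.2))
      = (((μ.prod (gaussianReal 0 v)).map (fun ω => ω.1)).prod
          ((μ.prod (gaussianReal 0 v)).map (fun ω => ω.1 + ω.2))).withDensity
          (fun p => ENNReal.ofReal (gaussTilt v p.1 p.2 / outputTilt μ v p.2)) := by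
  have hfst : (μ.prod (gaussianReal 0 v)).map (fun ω => ω.1) = μ :=
    Measure.map_fst_prod.trans (by simp)
  have hg : Measurable (fun p : ℝ × ℝ => outputTilt μ v p.2) :=
    measurable_outputTilt.comp measurable_snd
  have hq : Measurable (fun p : ℝ × ℝ => gaussTilt v p.1 p.2 / outputTilt μ v p.2) :=
    (measurable_gaussTilt v).div hg
  rw [hfst, map_output_eq_withDensity hv hμ, map_channel_eq_withDensity μ hv,
    prod_withDensity_right measurable_outputTilt.ennreal_ofReal,
    ← withDensity_mul _ hg.ennreal_ofReal hq.ennreal_ofReal]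
  congr 1
  ext p
  have hp := outputTilt_pos (v := v) hμ p.2
  rw [Pi.mul_apply, ← ENNReal.ofReal_mul hp.le, mul_div_cancel₀ _ hp.ne']

lemma integrable_id_of_ae_abs_le (hμ : ∀ᵐ x ∂μ, |x| ≤ A) : Integrable (fun x => x) μ :=
  Integrable.of_bound measurable_id.aestronglyMeasurable A hμ

lemma integrable_sq_of_ae_abs_le (hμ : ∀ᵐ x ∂μ, |x| ≤ A) : Integrable (fun x => x ^ 2) μ := by
  refine Integrable.of_bound (by fun_prop) (A ^ 2) ?_
  filter_upwards [hμ] with x hx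
  rw [Real.norm_of_nonneg (sq_nonneg x), ← sq_abs]
  gcongr

lemma integrable_id_gaussianReal : Integrable (fun x => x) (gaussianReal 0 v) :=
  (memLp_id_gaussianReal (μ := 0) (v := v) 1).integrable (by norm_num)

lemma integrable_sq_gaussianReal : Integrable (fun x => x ^ 2) (gaussianReal 0 v) :=
  (memLp_id_gaussianReal (μ := 0) (v := v) 2).integrable_sq

lemma integral_sq_gaussianReal : ∫ x, x ^ 2 ∂(gaussianReal 0 v) = v := by
  have h := variance_eq_sub (memLp_id_gaussianReal (μ := 0) (v := v) 2)
  rw [variance_id_gaussianReal] at h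
  simpa using h.symm

lemma integrable_mul_prod_gaussianReal (hμ : ∀ᵐ x ∂μ, |x| ≤ A) :
    Integrable (fun ω : ℝ × ℝ => ω.1 * ω.2) (μ.prod (gaussianReal 0 v)) :=
  (integrable_id_of_ae_abs_le hμ).mul_prod integrable_id_gaussianReal

lemma integral_mul_prod_gaussianReal :
    ∫ ω, ω.1 * ω.2 ∂(μ.prod (gaussianReal 0 v)) = 0 := by
  rw [integral_prod_mul (fun x => x) (fun x => x)]
  simp

lemma integrable_exponent (hμ : ∀ᵐ x ∂μ, |x| ≤ A) :
    Integrable (fun ω : ℝ × ℝ => ω.1 * (ω.1 + ω.2) / v - ω.1 ^ 2 / (2 * v))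
      (μ.prod (gaussianReal 0 v)) := by
  have h1 := (integrable_sq_of_ae_abs_le hμ).comp_fst (gaussianReal 0 v)
  refine (((h1.add (integrable_mul_prod_gaussianReal hμ)).div_const (v : ℝ)).sub
    (h1.div_const (2 * v : ℝ))).congr (ae_of_all _ fun ω => ?_)
  simp only [Pi.add_apply, Pi.sub_apply]
  ring

lemma integral_exponent (hμ : ∀ᵐ x ∂μ, |x| ≤ A) :
    ∫ ω, (ω.1 * (ω.1 + ω.2) / v - ω.1 ^ 2 / (2 * v)) ∂(μ.prod (gaussianReal 0 v))
      = (∫ x, x ^ 2 ∂μ) / (2 * v) := by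
  have h1 := (integrable_sq_of_ae_abs_le hμ).comp_fst (gaussianReal 0 v)
  have h2 := integrable_mul_prod_gaussianReal (v := v) hμ
  have h3 : ∫ ω : ℝ × ℝ, ω.1 ^ 2 ∂(μ.prod (gaussianReal 0 v)) = ∫ x, x ^ 2 ∂μ := by
    simpa using integral_fun_fst (μ := μ) (ν := gaussianReal 0 v) (fun x : ℝ => x ^ 2)
  calc _ = ∫ ω : ℝ × ℝ, (ω.1 ^ 2 / (2 * v) + ω.1 * ω.2 / v) ∂(μ.prod (gaussianReal 0 v)) :=
        integral_congr_ae (ae_of_all _ fun ω => by simp only; ring)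
    _ = _ := by
      rw [integral_add (h1.div_const _) (h2.div_const _), integral_div, integral_div,
        integral_mul_prod_gaussianReal, h3]
      simp

lemma integrable_log_outputTilt (hμ : ∀ᵐ x ∂μ, |x| ≤ A) :
    Integrable (fun ω : ℝ × ℝ => Real.log (outputTilt μ v (ω.1 + ω.2)))
      (μ.prod (gaussianReal 0 v)) := by
  have h1 : Integrable (fun ω : ℝ × ℝ => ω.1 + ω.2) (μ.prod (gaussianReal 0 v)) :=
    ((integrable_id_of_ae_abs_le hμ).comp_fst _).add (integrable_id_gaussianReal.comp_snd _)
  refine Integrable.mono' (((h1.abs.const_mul A).div_const (v : ℝ)).add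
    (integrable_const (A ^ 2 / (2 * v : ℝ)))) ?_ (ae_of_all _ fun ω => ?_)
  · exact (Real.measurable_log.comp
      (measurable_outputTilt.comp (measurable_fst.add measurable_snd))).aestronglyMeasurable
  · exact abs_log_outputTilt_le hμ _

/-- The mutual information between the input and the output of the Gaussian channel, for an input
of bounded amplitude. -/
lemma mutualInfo_channel (hv : v ≠ 0) (hμ : ∀ᵐ x ∂μ, |x| ≤ A) :
    mutualInfo (μ.prod (gaussianReal 0 v)) (fun ω => ω.1) (fun ω => ω.1 + ω.2)
      = (((∫ x, x ^ 2 ∂μ) / (2 * v) - ∫ ω, Real.log (outputTilt μ v (ω.1 + ω.2))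
          ∂(μ.prod (gaussianReal 0 v)) : ℝ) : EReal) := by
  have hJ := map_channel_eq_withDensity_prod hv hμ
  unfold mutualInfo
  set J := (μ.prod (gaussianReal 0 v)).map (fun ω => (ω.1, ω.1 + ω.2)) with hJdef
  set Q := ((μ.prod (gaussianReal 0 v)).map (fun ω => ω.1)).prod
    ((μ.prod (gaussianReal 0 v)).map (fun ω => ω.1 + ω.2)) with hQdef
  have hg : Measurable (fun p : ℝ × ℝ => outputTilt μ v p.2) :=
    measurable_outputTilt.comp measurable_snd
  have hac : J ≪ Q := by rw [hJ]; exact withDensity_absolutelyContinuous _ _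
  have hm1 : Measurable (fun ω : ℝ × ℝ => ω.1) := measurable_fst
  have hm2 : Measurable (fun ω : ℝ × ℝ => ω.1 + ω.2) := by fun_prop
  have : IsProbabilityMeasure ((μ.prod (gaussianReal 0 v)).map (fun ω => ω.1)) :=
    Measure.isProbabilityMeasure_map hm1.aemeasurable
  have : IsProbabilityMeasure ((μ.prod (gaussianReal 0 v)).map (fun ω => ω.1 + ω.2)) :=
    Measure.isProbabilityMeasure_map hm2.aemeasurable
  have hrn : J.rnDeriv Q =ᵐ[Q]
      fun p => ENNReal.ofReal (gaussTilt v p.1 p.2 / outputTilt μ v p.2) := by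
    rw [hJ]
    exact Measure.rnDeriv_withDensity _ ((measurable_gaussTilt v).div hg).ennreal_ofReal
  have hllr : llr J Q =ᵐ[J] fun p => (p.1 * p.2 / v - p.1 ^ 2 / (2 * v))
      - Real.log (outputTilt μ v p.2) := by
    filter_upwards [hac.ae_le hrn] with p hp
    have hgp := outputTilt_pos (v := v) hμ p.2
    rw [llr_def]
    simp only
    rw [hp, ENNReal.toReal_ofReal (div_pos (gaussTilt_pos _ _ _) hgp).le,
      Real.log_div (gaussTilt_pos _ _ _).ne' hgp.ne', gaussTilt, Real.log_exp]
  have hmeas : Measurable (fun p : ℝ × ℝ => (p.1 * p.2 / v - p.1 ^ 2 / (2 * v))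
      - Real.log (outputTilt μ v p.2)) := by
    have := Real.measurable_log.comp hg
    exact Measurable.sub (by fun_prop) this
  have hmap : Measurable (fun ω : ℝ × ℝ => (ω.1, ω.1 + ω.2)) := by fun_prop
  have hint : Integrable (llr J Q) J := by
    rw [integrable_congr hllr, hJdef,
      integrable_map_measure hmeas.aestronglyMeasurable hmap.aemeasurable]
    exact (integrable_exponent hμ).sub (integrable_log_outputTilt hμ)
  rw [klDiv, if_pos ⟨hac, hint⟩, integral_congr_ae hllr, hJdef,
    integral_map hmap.aemeasurable hmeas.aestronglyMeasurable,
    integral_sub (integrable_exponent hμ) (integrable_log_outputTilt hμ), integral_exponent hμ]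

lemma integral_log_outputTilt_nonneg (hv : v ≠ 0) (hμ : ∀ᵐ x ∂μ, |x| ≤ A) :
    0 ≤ ∫ ω, Real.log (outputTilt μ v (ω.1 + ω.2)) ∂(μ.prod (gaussianReal 0 v)) := by
  have hm2 : Measurable (fun ω : ℝ × ℝ => ω.1 + ω.2) := by fun_prop
  have hgm : Measurable (fun y => ENNReal.ofReal (outputTilt μ v y)) :=
    measurable_outputTilt.ennreal_ofReal
  have hlt : ∀ᵐ y ∂(gaussianReal 0 v), ENNReal.ofReal (outputTilt μ v y) < ⊤ :=
    ae_of_all _ fun _ => ENNReal.ofReal_lt_top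
  have hone : ∀ y, (ENNReal.ofReal (outputTilt μ v y)).toReal • (outputTilt μ v y)⁻¹ = 1 :=
    fun y => by
      have hp := outputTilt_pos (v := v) hμ y
      rw [ENNReal.toReal_ofReal hp.le, smul_eq_mul, mul_inv_cancel₀ hp.ne']
  have hinv : Measurable (fun y => (outputTilt μ v y)⁻¹) := measurable_outputTilt.inv
  have hi : Integrable (fun ω : ℝ × ℝ => (outputTilt μ v (ω.1 + ω.2))⁻¹)
      (μ.prod (gaussianReal 0 v)) := by
    have : Integrable (fun y => (outputTilt μ v y)⁻¹)
        ((μ.prod (gaussianReal 0 v)).map (fun ω => ω.1 + ω.2)) := by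
      rw [map_output_eq_withDensity hv hμ, integrable_withDensity_iff_integrable_smul' hgm hlt]
      simp_rw [hone]
      exact integrable_const 1
    exact (integrable_map_measure hinv.aestronglyMeasurable hm2.aemeasurable).1 this
  have hI : ∫ ω : ℝ × ℝ, (outputTilt μ v (ω.1 + ω.2))⁻¹ ∂(μ.prod (gaussianReal 0 v)) = 1 := by
    rw [← integral_map hm2.aemeasurable hinv.aestronglyMeasurable,
      map_output_eq_withDensity hv hμ, integral_withDensity_eq_integral_toReal_smul hgm hlt]
    simp_rw [hone]
    simp
  have hmono : ∫ ω : ℝ × ℝ, (1 - (outputTilt μ v (ω.1 + ω.2))⁻¹) ∂(μ.prod (gaussianReal 0 v))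
      ≤ ∫ ω, Real.log (outputTilt μ v (ω.1 + ω.2)) ∂(μ.prod (gaussianReal 0 v)) :=
    integral_mono ((integrable_const _).sub hi) (integrable_log_outputTilt hμ)
      fun ω => Real.one_sub_inv_le_log_of_pos (outputTilt_pos hμ _)
  rw [integral_sub (integrable_const _) hi, hI] at hmono
  simpa using hmono

lemma mutualInfo_channel_le (hv : v ≠ 0) (hμ : ∀ᵐ x ∂μ, |x| ≤ A) :
    mutualInfo (μ.prod (gaussianReal 0 v)) (fun ω => ω.1) (fun ω => ω.1 + ω.2)
      ≤ ((A ^ 2 / (2 * v) : ℝ) : EReal) := by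
  rw [mutualInfo_channel hv hμ, EReal.coe_le_coe_iff]
  have h0 := integral_log_outputTilt_nonneg hv hμ
  have h1 : ∫ x, x ^ 2 ∂μ ≤ A ^ 2 := by
    have : ∫ x, x ^ 2 ∂μ ≤ ∫ _, A ^ 2 ∂μ := by
      refine integral_mono_ae (integrable_sq_of_ae_abs_le hμ) (integrable_const _) ?_
      filter_upwards [hμ] with x hx
      rw [← sq_abs]
      gcongr
    simpa using this
  have h2 : (∫ x, x ^ 2 ∂μ) / (2 * v) ≤ A ^ 2 / (2 * v) := by gcongr
  linarith

end Channel

/-- The uniform law on `{A, -A}`. -/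
def antipodal (A : ℝ) : Measure ℝ :=
  (2⁻¹ : ENNReal) • Measure.dirac A + (2⁻¹ : ENNReal) • Measure.dirac (-A)

instance (A : ℝ) : IsProbabilityMeasure (antipodal A) :=
  ⟨by simp [antipodal, ENNReal.inv_two_add_inv_two]⟩

lemma antipodal_compl_Icc {A : ℝ} (hA : 0 ≤ A) : antipodal A (Set.Icc (-A) A)ᶜ = 0 := by
  have h : -A ≤ A := by linarith
  simp [antipodal, measurableSet_Icc.compl, h]

lemma integral_antipodal (A : ℝ) (f : ℝ → ℝ) :
    ∫ x, f x ∂(antipodal A) = (f A + f (-A)) / 2 := by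
  have h (a : ℝ) : Integrable f ((2⁻¹ : ENNReal) • Measure.dirac a) :=
    (integrable_dirac (by simp)).smul_measure (by simp)
  rw [antipodal, integral_add_measure (h _) (h _), integral_smul_measure, integral_smul_measure,
    integral_dirac, integral_dirac]
  simp
  ring

lemma log_outputTilt_antipodal_le (A : ℝ) (v : NNReal) (y : ℝ) :
    Real.log (outputTilt (antipodal A) v y)
      ≤ A ^ 2 * y ^ 2 / (2 * v ^ 2) - A ^ 2 / (2 * v) := by
  have h : outputTilt (antipodal A) v y
      = Real.exp (-(A ^ 2 / (2 * v))) * Real.cosh (A * y / v) := by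
    rw [outputTilt, integral_antipodal, gaussTilt, gaussTilt, Real.cosh_eq, sub_eq_add_neg,
      Real.exp_add, sub_eq_add_neg, Real.exp_add, neg_sq, neg_mul, neg_div]
    ring
  rw [h, Real.log_mul (Real.exp_pos _).ne' (Real.cosh_pos _).ne', Real.log_exp]
  have h2 : Real.log (Real.cosh (A * y / v)) ≤ (A * y / v) ^ 2 / 2 :=
    (Real.log_le_iff_le_exp (Real.cosh_pos _)).2 (Real.cosh_le_exp_half_sq _)
  have h3 : (A * y / v) ^ 2 / 2 = A ^ 2 * y ^ 2 / (2 * v ^ 2) := by ring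
  linarith

lemma le_mutualInfo_antipodal {A : ℝ} (hA : 0 ≤ A) {v : NNReal} (hv : v ≠ 0) :
    ((A ^ 2 / (2 * v) - A ^ 4 / (2 * v ^ 2) : ℝ) : EReal)
      ≤ mutualInfo ((antipodal A).prod (gaussianReal 0 v)) (fun ω => ω.1)
          (fun ω => ω.1 + ω.2) := by
  have hμ := ae_abs_le_of_compl_Icc (antipodal_compl_Icc hA)
  rw [mutualInfo_channel hv hμ, EReal.coe_le_coe_iff, integral_antipodal A (fun x => x ^ 2)]
  have h1 := (integrable_sq_of_ae_abs_le hμ).comp_fst (gaussianReal 0 v)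
  have h2 := integrable_mul_prod_gaussianReal (v := v) hμ
  have h3 := (integrable_sq_gaussianReal (v := v)).comp_snd (antipodal A)
  have e1 : ∫ ω : ℝ × ℝ, ω.1 ^ 2 ∂((antipodal A).prod (gaussianReal 0 v)) = A ^ 2 := by
    have := integral_fun_fst (μ := antipodal A) (ν := gaussianReal 0 v) (fun x : ℝ => x ^ 2)
    rw [this, integral_antipodal]
    simp
  have e3 : ∫ ω : ℝ × ℝ, ω.2 ^ 2 ∂((antipodal A).prod (gaussianReal 0 v)) = v := by
    have := integral_fun_snd (μ := antipodal A) (ν := gaussianReal 0 v) (fun x : ℝ => x ^ 2)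
    rw [this, integral_sq_gaussianReal]
    simp
  have h12 : Integrable (fun ω : ℝ × ℝ => ω.1 ^ 2 + 2 * (ω.1 * ω.2))
      ((antipodal A).prod (gaussianReal 0 v)) := h1.add (h2.const_mul 2)
  have hsq : Integrable (fun ω : ℝ × ℝ => (ω.1 + ω.2) ^ 2)
      ((antipodal A).prod (gaussianReal 0 v)) :=
    (h12.add h3).congr (ae_of_all _ fun ω => by simp only [Pi.add_apply]; ring)
  have e : ∫ ω : ℝ × ℝ, (ω.1 + ω.2) ^ 2 ∂((antipodal A).prod (gaussianReal 0 v))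
      = A ^ 2 + v := by
    calc _ = ∫ ω : ℝ × ℝ, (ω.1 ^ 2 + 2 * (ω.1 * ω.2) + ω.2 ^ 2)
          ∂((antipodal A).prod (gaussianReal 0 v)) :=
          integral_congr_ae (ae_of_all _ fun ω => by simp only; ring)
      _ = _ := by
        rw [integral_add h12 h3, integral_add h1 (h2.const_mul 2),
          integral_const_mul, integral_mul_prod_gaussianReal, e1, e3]
        ring
  have hi := (hsq.const_mul (A ^ 2)).div_const (2 * v ^ 2 : ℝ)
  have hle := integral_mono (integrable_log_outputTilt (v := v) hμ)
    (hi.sub (integrable_const (A ^ 2 / (2 * v : ℝ))))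
    fun ω => log_outputTilt_antipodal_le A v (ω.1 + ω.2)
  have hR : ∫ ω : ℝ × ℝ, (A ^ 2 * (ω.1 + ω.2) ^ 2 / (2 * v ^ 2) - A ^ 2 / (2 * v))
      ∂((antipodal A).prod (gaussianReal 0 v)) = A ^ 4 / (2 * v ^ 2) := by
    rw [integral_sub hi (integrable_const _), integral_div, integral_const_mul, e]
    simp
    field_simp
    ring
  have hle' := hle.trans_eq hR
  have h4 : (A ^ 2 + (-A) ^ 2) / 2 / (2 * v) = A ^ 2 / (2 * v : ℝ) := by ring
  simp only [h4]
  linarith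

lemma gaussCap_le (A : ℝ) {σ : ℝ} (hσ : 0 < σ) :
    gaussCap A σ ≤ ((A ^ 2 / (2 * σ ^ 2) : ℝ) : EReal) := by
  refine sSup_le ?_
  rintro r ⟨μ, hμ, hA, rfl⟩
  have hv : (σ ^ 2).toNNReal ≠ 0 := (Real.toNNReal_pos.2 (by positivity)).ne'
  simpa [Real.coe_toNNReal _ (sq_nonneg σ)] using
    mutualInfo_channel_le hv (ae_abs_le_of_compl_Icc hA)

lemma le_gaussCap {A : ℝ} (hA : 0 ≤ A) {σ : ℝ} (hσ : 0 < σ) :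
    ((A ^ 2 / (2 * σ ^ 2) - A ^ 4 / (2 * (σ ^ 2) ^ 2) : ℝ) : EReal) ≤ gaussCap A σ := by
  have hv : (σ ^ 2).toNNReal ≠ 0 := (Real.toNNReal_pos.2 (by positivity)).ne'
  have h := le_mutualInfo_antipodal hA hv
  rw [Real.coe_toNNReal _ (sq_nonneg σ)] at h
  exact h.trans (le_sSup ⟨antipodal A, inferInstance, antipodal_compl_Icc hA, rfl⟩)

/-- For small `A`, the amplitude-constrained Gaussian channel capacity satisfies
`C(A,σ) / (A²/(2σ²)) → 1` as `A → 0⁺`. -/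
theorem stmt8 (σ : ℝ) (hσ : 0 < σ) :
    Tendsto (fun A => gaussCap A σ / ((A ^ 2 / (2 * σ ^ 2) : ℝ) : EReal))
      (nhdsWithin 0 (Set.Ioi 0)) (nhds 1) := by
  have hlim : Tendsto (fun A : ℝ => ((1 - A ^ 2 / σ ^ 2 : ℝ) : EReal))
      (nhdsWithin 0 (Set.Ioi 0)) (nhds 1) := by
    have hc : Continuous (fun A : ℝ => ((1 - A ^ 2 / σ ^ 2 : ℝ) : EReal)) :=
      continuous_coe_real_ereal.comp (by fun_prop)
    simpa using (hc.tendsto 0).mono_left nhdsWithin_le_nhds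
  refine tendsto_of_tendsto_of_tendsto_of_le_of_le' hlim tendsto_const_nhds ?_ ?_
  · filter_upwards [self_mem_nhdsWithin] with A hA
    have hA : 0 < A := hA
    have hpos : (0 : EReal) < ((A ^ 2 / (2 * σ ^ 2) : ℝ) : EReal) :=
      EReal.coe_pos.2 (by positivity)
    rw [EReal.le_div_iff_mul_le hpos (EReal.coe_ne_top _), ← EReal.coe_mul]
    convert le_gaussCap hA.le hσ using 2
    field_simp
  · filter_upwards [self_mem_nhdsWithin] with A hA
    have hA : 0 < A := hA
    have hpos : (0 : EReal) < ((A ^ 2 / (2 * σ ^ 2) : ℝ) : EReal) :=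
      EReal.coe_pos.2 (by positivity)
    rw [EReal.div_le_iff_le_mul hpos (EReal.coe_ne_top _), mul_one]
    exact gaussCap_le A hσ

end
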